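/- arXiv:1504.01719 — 2 statements merged into one kernel-verified Lean document; each statement's English description precedes it below -/
import Mathlib

section
/- The product ⋆ on KP is associative with two-sided unit M_ε; that is, (KP, ⋆) is an associative unital algebra. -/
open scoped Classical

/-- Words on natural numbers (letters are intended to be positive integers). -/
abbrev W : Type := List ℕ

/-- `IsPF a` : the word `a` is a parking function, i.e. all its letters are
positive and its nondecreasing rearrangement `b₁ b₂ ⋯ bₙ` satisfies `bᵢ ≤ i`. -/
def IsPF (a : W) : Prop :=
  (∀ x ∈ a, 1 ≤ x) ∧
    ∀ i, i < a.length → (a.insertionSort (· ≤ ·)).getD i 0 ≤ i + 1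

/-- Split a word into the consecutive segments beginning at its
left-to-right minima (in the order in which they occur in the word). -/
def segs : W → List W
  | [] => []
  | x :: xs =>
      (x :: xs.takeWhile fun y => x ≤ y) :: segs (xs.dropWhile fun y => x ≤ y)
termination_by a => a.length
decreasing_by
  simpa using Nat.lt_succ_of_le (List.dropWhile_sublist _).length_le

/-- The LR-decomposition `F_a` of a word `a`: the sequence of segments beginning
at the left-to-right minima, listed in increasing order of their minimal letters
(i.e. in reverse order of occurrence in `a`). -/
def LR (a : W) : List W := (segs a).reverse

/-- The word `w_k ⋯ w_2 w_1` encoded by an LR-decomposition `(w_1, …, w_k)`. -/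
def wordOf (F : List W) : W := F.reverse.flatten

/-- A word is dominated if it is nonempty and its first letter is its minimal letter. -/
def Dominated (w : W) : Prop := w ≠ [] ∧ ∀ x ∈ w, w.headD 0 ≤ x

/-- The minimal letter of a word (`0` for the empty word). -/
def minW (w : W) : ℕ := (w.min?).getD 0

/-- Add `m` to every letter of a word. -/
def shiftW (m : ℕ) (w : W) : W := w.map (· + m)

/-- Add `m` to every letter of every word of a sequence of words. -/
def shiftF (m : ℕ) (F : List W) : List W := F.map (shiftW m)

/-- The word whose LR-decomposition is the finite set of words `G`:
sort `G` increasingly (for dominated words with distinct minimal letters the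
lexicographic order agrees with comparing the minimal letters) and concatenate
in decreasing order. -/
noncomputable def wordOfSet (G : Finset W) : W := (G.sort (· ≤ ·)).reverse.flatten

/-- Given vertex sets `X`, `Y` (of words) and a set `Θ` of edges, the resulting
set of words: concatenations `u ++ w` over edges `(u, w) ∈ Θ`, together with all
unmatched words of `X` and of `Y`. -/
noncomputable def glueSet (X Y : Finset W) (Θ : Finset (W × W)) : Finset W :=
  Θ.image (fun p => p.1 ++ p.2) ∪
    X.filter (fun u => ∀ p ∈ Θ, p.1 ≠ u) ∪
    Y.filter (fun w => ∀ p ∈ Θ, p.2 ≠ w)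

/-- `R(a,b)` : the set of matchings between `F_a` and `F_b + m` (`m` the length
of `a`), encoded as sets of edges in which no vertex occurs twice. -/
noncomputable def Rset (a b : W) : Finset (Finset (W × W)) :=
  ((LR a).toFinset ×ˢ (shiftF a.length (LR b)).toFinset).powerset.filter
    (fun Θ => ∀ p ∈ Θ, ∀ q ∈ Θ, (p.1 = q.1 ∨ p.2 = q.2) → p = q)

/-- `aΘb` : the parking function whose LR-decomposition consists of the
concatenations `u ⬝ (w + m)` over the edges `(u, w + m)` of `Θ` together with all
unmatched words of `F_a` and of `F_b + m`. -/
noncomputable def mTheta (a b : W) (Θ : Finset (W × W)) : W :=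
  wordOfSet (glueSet (LR a).toFinset (shiftF a.length (LR b)).toFinset Θ)

/-- `d(a) = min { i : #{ j : a_j ≤ i } < i }`. -/
def dVal (a : W) : ℕ :=
  Nat.find (p := fun i => (a.filter (fun x => x ≤ i)).length < i)
    ⟨a.length + 1, Nat.lt_succ_of_le (List.length_filter_le _ _)⟩

/-- One step of the parkization algorithm: decrement every letter greater
than `d(a)`.  (This is the identity when `a` is a parking function.) -/
def parkStep (a : W) : W := a.map fun x => if dVal a < x then x - 1 else x

/-- Auxiliary fueled version of the parkization algorithm. -/
def parkFuel : ℕ → W → W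
  | 0, a => a
  | k + 1, a => if dVal a = a.length + 1 then a else parkFuel k (parkStep a)

/-- The parkization `Park a` of a word `a`.  (For a word with positive letters
the algorithm needs at most `a.sum` steps, so the fuel below suffices.) -/
def Park (a : W) : W := parkFuel a.sum a

/-- The subword of `a` obtained by keeping exactly the words of `F_a`
belonging to `S`. -/
def subWord (a : W) (S : Finset W) : W := wordOf ((LR a).filter (· ∈ S))

/-- The free module with basis indexed by words; the Hopf algebra `PFSym` is
its submodule spanned by `{M_a : a ∈ P}`. -/
abbrev FW (K : Type) [Field K] : Type := W →₀ K

/-- The monomial basis element `M_a`. -/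
noncomputable def Mb (K : Type) [Field K] (a : W) : FW K := Finsupp.single a 1

/-- `M_a ⋆ M_b = Σ_{Θ ∈ R(a,b)} M_{aΘb}` on basis elements. -/
noncomputable def mulSingle (K : Type) [Field K] (a b : W) : FW K :=
  ∑ Θ ∈ Rset a b, Mb K (mTheta a b Θ)

/-- The product `⋆`, extended bilinearly. -/
noncomputable def starF (K : Type) [Field K] (x y : FW K) : FW K :=
  x.sum fun a ca => y.sum fun b cb => (ca * cb) • mulSingle K a b

/-- The free module with basis indexed by pairs of words; it realizes the
tensor square of `FW K` via `M_a ⊗ M_b ↦ single (a,b)`. -/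
abbrev FW2 (K : Type) [Field K] : Type := (W × W) →₀ K

/-- `Δ(M_a) = Σ M_{Park a'} ⊗ M_{Park a''}` over ordered pairs `(a', a'')` of
subwords of `a` with `F_{a'} ⊍ F_{a''} = F_a` (encoded by the subset
`S ⊆ F_a` of words kept in `a'`). -/
noncomputable def deltaSingle (K : Type) [Field K] (a : W) : FW2 K :=
  ∑ S ∈ ((LR a).toFinset).powerset,
    Finsupp.single
      (Park (subWord a S), Park (subWord a (((LR a).toFinset) \ S))) 1

/-- The coproduct `Δ`, extended linearly. -/
noncomputable def deltaF (K : Type) [Field K] (x : FW K) : FW2 K :=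
  x.sum fun a ca => ca • deltaSingle K a

/-- The componentwise product on the tensor square, on basis elements:
`(M_a ⊗ M_b) ⋆ (M_c ⊗ M_d) = (M_a ⋆ M_c) ⊗ (M_b ⋆ M_d)`. -/
noncomputable def star2Single (K : Type) [Field K] (p q : W × W) : FW2 K :=
  ∑ Θ ∈ Rset p.1 q.1, ∑ Θ' ∈ Rset p.2 q.2,
    Finsupp.single (mTheta p.1 q.1 Θ, mTheta p.2 q.2 Θ') 1

/-- The componentwise product on the tensor square, extended bilinearly. -/
noncomputable def star2F (K : Type) [Field K] (x y : FW2 K) : FW2 K :=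
  x.sum fun p cp => y.sum fun q cq => (cp * cq) • star2Single K p q

/-- The counit `ε` on basis elements. -/
noncomputable def epsW (K : Type) [Field K] (a : W) : K := if a = [] then 1 else 0

/-- `F_a ∘ F_b` : concatenate the `i`-th words of `F_a` and `F_b + m`
for `i ≤ min(r,s)` and keep the remaining unpaired words. -/
def splitLR (F G : List W) : List W :=
  List.zipWith (· ++ ·) F G ++ F.drop G.length ++ G.drop F.length

/-- The split product `a ∘ b`. -/
def splitProd (a b : W) : W := wordOf (splitLR (LR a) (shiftF a.length (LR b)))

/-- A nonempty parking function is unsplitable if it is not the split product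
of two nonempty parking functions. -/
def UnsplitablePF (a : W) : Prop :=
  IsPF a ∧ a ≠ [] ∧
    ¬ ∃ b c : W, IsPF b ∧ IsPF c ∧ b ≠ [] ∧ c ≠ [] ∧ a = splitProd b c

/-- The slash product `a | b = (b₁+m) ⋯ (bₙ+m) a₁ ⋯ a_m`. -/
def slashProd (a b : W) : W := shiftW a.length b ++ a

/-- A nonempty parking function is atomic if it is not the slash product
of two nonempty parking functions. -/
def AtomicPF (a : W) : Prop :=
  IsPF a ∧ a ≠ [] ∧
    ¬ ∃ b c : W, IsPF b ∧ IsPF c ∧ b ≠ [] ∧ c ≠ [] ∧ a = slashProd b c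

/-- `u ≺* v` : either `v` is a proper initial subword of `u`, or `u` is not a
proper initial subword of `v` and `u` precedes `v` lexicographically. -/
def precStar (u v : W) : Prop :=
  (v <+: u ∧ v ≠ u) ∨ (¬ (u <+: v ∧ u ≠ v) ∧ List.Lex (· < ·) u v)

/-- `a ≺*_lex b` : `F_a` strictly precedes `F_b` in the lexicographic order
on sequences of words induced by `≺*`. -/
def precStarLex (a b : W) : Prop := List.Lex precStar (LR a) (LR b)

/-- The covering relation of `≤_*` : `b` covers `a` if `F_b` is obtained from
`F_a = (w_1, …, w_r)` by replacing `w_i` by `w_i ⬝ w_j` and removing `w_j`,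
for some `i < j` such that every letter of `w_i` is at most every letter of `w_j`. -/
def CovStar (a b : W) : Prop :=
  ∃ i j, i < j ∧ j < (LR a).length ∧
    (∀ x ∈ (LR a).getD i [], ∀ y ∈ (LR a).getD j [], x ≤ y) ∧
    LR b = ((LR a).set i ((LR a).getD i [] ++ (LR a).getD j [])).eraseIdx j

/-- The partial order `≤_*` on parking functions, generated by the covering
relations. -/
def leStar (a b : W) : Prop := Relation.ReflTransGen CovStar a b

/-- The finite set of all parking functions of length `n`. -/
noncomputable def pfFinset (n : ℕ) : Finset W :=
  ((Finset.univ : Finset (Fin n → Fin n)).image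
      (fun f => List.ofFn fun i => (f i).val + 1)).filter IsPF

/-- The basis element `Q_a = Σ_{a ≤_* b} M_b`. -/
noncomputable def Qb (K : Type) [Field K] (a : W) : FW K :=
  ∑ b ∈ (pfFinset a.length).filter (fun b => leStar a b), Mb K b

/-- `Q_x ⊗ Q_y` as an element of the tensor square. -/
noncomputable def QT (K : Type) [Field K] (x y : W) : FW2 K :=
  ∑ b ∈ (pfFinset x.length).filter (fun b => leStar x b),
    ∑ c ∈ (pfFinset y.length).filter (fun c => leStar y c),
      Finsupp.single (b, c) 1

/-- `a` is a nonincreasing word. -/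
def NonInc (a : W) : Prop := a.Chain' (fun x y => y ≤ x)

/-- Every word of the LR-decomposition of `a` is nondecreasing. -/
def Nprop (a : W) : Prop := ∀ w ∈ LR a, w.Chain' (· ≤ ·)

/-- The words of the LR-decomposition of `a` have pairwise disjoint sets of letters. -/
def Dprop (a : W) : Prop := (LR a).Pairwise (fun u v => ∀ x ∈ u, x ∉ v)

/-- `a` is a permutation of `{1, …, n}` viewed as a word. -/
def Sprop (a : W) : Prop := a.Perm (List.range' 1 a.length)



def fl (k : ℕ) (g : W) : W := g.filter (fun x => decide (x ≤ k))
def fh (k : ℕ) (g : W) : W := g.filter (fun x => decide (k < x))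

structure QQ (k : ℕ) (X Y G : Finset W) : Prop where
  ne : ∀ g ∈ G, g ≠ []
  dec : ∀ g ∈ G, fl k g ++ fh k g = g
  memX : ∀ x, x ∈ X ↔ x ≠ [] ∧ ∃ g ∈ G, fl k g = x
  memY : ∀ x, x ∈ Y ↔ x ≠ [] ∧ ∃ g ∈ G, fh k g = x
  injX : ∀ g ∈ G, ∀ g' ∈ G, fl k g = fl k g' → fl k g ≠ [] → g = g'
  injY : ∀ g ∈ G, ∀ g' ∈ G, fh k g = fh k g' → fh k g ≠ [] → g = g'

/-- Nonempty words with letters at most `k`. -/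
def Low (k : ℕ) (X : Finset W) : Prop := ∀ x ∈ X, x ≠ [] ∧ ∀ y ∈ x, y ≤ k
def High (k : ℕ) (X : Finset W) : Prop := ∀ x ∈ X, x ≠ [] ∧ ∀ y ∈ x, k < y

noncomputable def MS (X Y : Finset W) : Finset (Finset (W × W)) :=
  (X ×ˢ Y).powerset.filter
    (fun Θ => ∀ p ∈ Θ, ∀ q ∈ Θ, (p.1 = q.1 ∨ p.2 = q.2) → p = q)

theorem fl_low {k : ℕ} {g : W} (h : ∀ y ∈ g, y ≤ k) : fl k g = g := by
  unfold fl; rw [List.filter_eq_self]; simpa using h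
theorem fh_low {k : ℕ} {g : W} (h : ∀ y ∈ g, y ≤ k) : fh k g = [] := by
  unfold fh; rw [List.filter_eq_nil_iff]; simpa using h
theorem fl_high {k : ℕ} {g : W} (h : ∀ y ∈ g, k < y) : fl k g = [] := by
  unfold fl; rw [List.filter_eq_nil_iff]; simpa using h
theorem fh_high {k : ℕ} {g : W} (h : ∀ y ∈ g, k < y) : fh k g = g := by
  unfold fh; rw [List.filter_eq_self]; simpa using h
theorem fl_append (k : ℕ) (g h : W) : fl k (g ++ h) = fl k g ++ fl k h := by simp [fl]
theorem fh_append (k : ℕ) (g h : W) : fh k (g ++ h) = fh k g ++ fh k h := by simp [fh]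

theorem mem_MS {X Y : Finset W} {Θ : Finset (W × W)} :
    Θ ∈ MS X Y ↔ (∀ u w, (u, w) ∈ Θ → u ∈ X ∧ w ∈ Y) ∧
      (∀ u w w', (u, w) ∈ Θ → (u, w') ∈ Θ → w = w') ∧
      (∀ u u' w, (u, w) ∈ Θ → (u', w) ∈ Θ → u = u') := by
  unfold MS
  rw [Finset.mem_filter, Finset.mem_powerset]
  constructor
  · rintro ⟨h1, h2⟩
    refine ⟨fun u w h => by simpa using h1 h, ?_, ?_⟩
    · intro u w w' h h'
      have := h2 _ h _ h' (Or.inl rfl)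
      simpa using this
    · intro u w w' h h'
      have := h2 _ h _ h' (Or.inr rfl)
      simpa using this
  · rintro ⟨h1, h2, h3⟩
    refine ⟨fun ⟨u, w⟩ h => by simpa using h1 u w h, ?_⟩
    rintro ⟨u, w⟩ h ⟨u', w'⟩ h' (e | e)
    · simp only at e; subst e; rw [h2 _ _ _ h h']
    · simp only at e; subst e; rw [h3 _ _ _ h h']

theorem mem_glue {X Y : Finset W} {Θ : Finset (W × W)} {g : W} :
    g ∈ glueSet X Y Θ ↔ (∃ u w, (u, w) ∈ Θ ∧ u ++ w = g) ∨
      (g ∈ X ∧ ∀ w, (g, w) ∉ Θ) ∨ (g ∈ Y ∧ ∀ u, (u, g) ∉ Θ) := by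
  unfold glueSet
  simp only [Finset.mem_union, Finset.mem_image, Finset.mem_filter, Prod.exists, Prod.forall,
    or_assoc]
  refine or_congr Iff.rfl (or_congr (and_congr Iff.rfl ?_) (and_congr Iff.rfl ?_)) <;> aesop

/-- full case description of elements of a glue -/
theorem glue_cases {k : ℕ} {X Y : Finset W} (hX : Low k X) (hY : High k Y)
    {Θ : Finset (W × W)} (hΘ : Θ ∈ MS X Y) {g : W} :
    g ∈ glueSet X Y Θ ↔ (fl k g ++ fh k g = g) ∧
      (((fl k g, fh k g) ∈ Θ ∧ fl k g ≠ [] ∧ fh k g ≠ []) ∨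
      (fl k g ∈ X ∧ fl k g ≠ [] ∧ fh k g = [] ∧ ∀ w, (fl k g, w) ∉ Θ) ∨
      (fh k g ∈ Y ∧ fl k g = [] ∧ fh k g ≠ [] ∧ ∀ u, (u, fh k g) ∉ Θ)) := by
  rw [mem_MS] at hΘ
  rw [mem_glue]
  constructor
  · rintro (⟨u, w, h, rfl⟩ | ⟨h, h'⟩ | ⟨h, h'⟩)
    · obtain ⟨hu, hw⟩ := hΘ.1 u w h
      obtain ⟨u1, u2⟩ := hX u hu
      obtain ⟨w1, w2⟩ := hY w hw
      rw [fl_append, fh_append, fl_low u2, fh_low u2, fl_high w2, fh_high w2]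
      simp [h, u1, w1]
    · obtain ⟨u1, u2⟩ := hX g h
      rw [fl_low u2, fh_low u2]
      simp [h, u1, h']
    · obtain ⟨u1, u2⟩ := hY g h
      rw [fl_high u2, fh_high u2]
      simp [h, u1, h']
  · rintro ⟨e, ⟨h, -⟩ | ⟨h1, h2, h3, h4⟩ | ⟨h1, h2, h3, h4⟩⟩
    · exact Or.inl ⟨_, _, h, e⟩
    · rw [h3, List.append_nil] at e
      rw [e] at h1 h4
      exact Or.inr (Or.inl ⟨h1, h4⟩)
    · rw [h2, List.nil_append] at e
      rw [e] at h1 h4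
      exact Or.inr (Or.inr ⟨h1, h4⟩)

theorem glue_QQ {k : ℕ} {X Y : Finset W} (hX : Low k X) (hY : High k Y)
    {Θ : Finset (W × W)} (hΘ : Θ ∈ MS X Y) : QQ k X Y (glueSet X Y Θ) := by
  have key := @glue_cases k X Y hX hY Θ hΘ
  have hΘ' := hΘ
  rw [mem_MS] at hΘ'
  obtain ⟨t1, t2, t3⟩ := hΘ'
  refine ⟨?_, ?_, ?_, ?_, ?_, ?_⟩
  · rintro g hg rfl
    rw [key] at hg
    simp [fl, fh] at hg
  · intro g hg
    rw [key] at hg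
    exact hg.1
  · intro x
    constructor
    · intro hx
      refine ⟨(hX x hx).1, ?_⟩
      by_cases h : ∃ w, (x, w) ∈ Θ
      · obtain ⟨w, hw⟩ := h
        refine ⟨x ++ w, mem_glue.2 (Or.inl ⟨x, w, hw, rfl⟩), ?_⟩
        rw [fl_append, fl_low (hX x hx).2, fl_high (hY w (t1 _ _ hw).2).2, List.append_nil]
      · push Not at h
        exact ⟨x, mem_glue.2 (Or.inr (Or.inl ⟨hx, h⟩)), fl_low (hX x hx).2⟩
    · rintro ⟨hx, g, hg, rfl⟩
      rw [key] at hg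
      grind
  · intro x
    constructor
    · intro hx
      refine ⟨(hY x hx).1, ?_⟩
      by_cases h : ∃ w, (w, x) ∈ Θ
      · obtain ⟨w, hw⟩ := h
        refine ⟨w ++ x, mem_glue.2 (Or.inl ⟨w, x, hw, rfl⟩), ?_⟩
        rw [fh_append, fh_high (hY x hx).2, fh_low (hX w (t1 _ _ hw).1).2, List.nil_append]
      · push Not at h
        exact ⟨x, mem_glue.2 (Or.inr (Or.inr ⟨hx, h⟩)), fh_high (hY x hx).2⟩
    · rintro ⟨hx, g, hg, rfl⟩
      rw [key] at hg
      grind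
  · intro g hg g' hg' e ne
    rw [key] at hg hg'
    have : fh k g = fh k g' := by grind
    rw [← hg.1, ← hg'.1, e, this]
  · intro g hg g' hg' e ne
    rw [key] at hg hg'
    have : fl k g = fl k g' := by grind
    rw [← hg.1, ← hg'.1, e, this]

noncomputable def unglue (k : ℕ) (G : Finset W) : Finset (W × W) :=
  (G.filter (fun g => fl k g ≠ [] ∧ fh k g ≠ [])).image (fun g => (fl k g, fh k g))

theorem mem_unglue {k : ℕ} {G : Finset W} {u w : W} :
    (u, w) ∈ unglue k G ↔ u ≠ [] ∧ w ≠ [] ∧ ∃ g ∈ G, fl k g = u ∧ fh k g = w := by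
  unfold unglue
  simp only [Finset.mem_image, Finset.mem_filter, Prod.mk.injEq]
  grind

theorem unglue_glue {k : ℕ} {X Y : Finset W} (hX : Low k X) (hY : High k Y)
    {Θ : Finset (W × W)} (hΘ : Θ ∈ MS X Y) : unglue k (glueSet X Y Θ) = Θ := by
  have key := @glue_cases k X Y hX hY Θ hΘ
  ext ⟨u, w⟩
  rw [mem_unglue]
  constructor
  · rintro ⟨hu, hw, g, hg, rfl, rfl⟩
    rw [key] at hg
    grind
  · intro h
    obtain ⟨hu, hw⟩ := (mem_MS.1 hΘ).1 u w h
    obtain ⟨u1, u2⟩ := hX u hu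
    obtain ⟨w1, w2⟩ := hY w hw
    refine ⟨u1, w1, u ++ w, mem_glue.2 (Or.inl ⟨u, w, h, rfl⟩), ?_, ?_⟩
    · rw [fl_append, fl_low u2, fl_high w2, List.append_nil]
    · rw [fh_append, fh_low u2, fh_high w2, List.nil_append]

theorem QQ_unglue_mem {k : ℕ} {X Y G : Finset W} (h : QQ k X Y G) : unglue k G ∈ MS X Y := by
  obtain ⟨h1, h2, h3, h4, h5, h6⟩ := h
  rw [mem_MS]
  simp only [mem_unglue]
  refine ⟨?_, ?_, ?_⟩
  · rintro u w ⟨hu, hw, g, hg, rfl, rfl⟩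
    exact ⟨(h3 _).2 ⟨hu, g, hg, rfl⟩, (h4 _).2 ⟨hw, g, hg, rfl⟩⟩
  · rintro u w w' ⟨hu, hw, g, hg, rfl, rfl⟩ ⟨hu, hw, g', hg', e, rfl⟩
    rw [h5 g hg g' hg' e.symm hu]
  · rintro u u' w ⟨hu, hw, g, hg, rfl, rfl⟩ ⟨hu, hw, g', hg', rfl, e⟩
    rw [h6 g hg g' hg' e.symm hw]

theorem QQ_glue {k : ℕ} {X Y G : Finset W} (hX : Low k X) (hY : High k Y)
    (h : QQ k X Y G) : glueSet X Y (unglue k G) = G := by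
  have hM := QQ_unglue_mem h
  obtain ⟨h1, h2, h3, h4, h5, h6⟩ := h
  ext g
  rw [glue_cases hX hY hM]
  simp only [mem_unglue]
  constructor
  · rintro ⟨e, ⟨⟨-, -, g', hg', e1, e2⟩, -⟩ | ⟨a1, a2, a3, a4⟩ | ⟨a1, a2, a3, a4⟩⟩
    · rw [← e, ← e1, ← e2, h2 g' hg']; exact hg'
    · obtain ⟨-, g', hg', e'⟩ := (h3 _).1 a1
      have : fh k g' = [] := by
        by_contra hc
        exact a4 (fh k g') ⟨a2, hc, g', hg', e', rfl⟩
      rw [← e, ← e', a3, ← this, h2 g' hg']; exact hg'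
    · obtain ⟨-, g', hg', e'⟩ := (h4 _).1 a1
      have : fl k g' = [] := by
        by_contra hc
        exact a4 (fl k g') ⟨hc, a3, g', hg', rfl, e'⟩
      rw [← e, ← e', a2, ← this, h2 g' hg']; exact hg'
  · intro hg
    refine ⟨h2 g hg, ?_⟩
    by_cases c1 : fl k g = []
    · have c2 : fh k g ≠ [] := by
        intro c2; exact h1 g hg (by rw [← h2 g hg, c1, c2]; rfl)
      refine Or.inr (Or.inr ⟨(h4 _).2 ⟨c2, g, hg, rfl⟩, c1, c2, ?_⟩)
      rintro u ⟨hu, -, g', hg', rfl, e⟩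
      exact hu (by rw [← h6 g hg g' hg' e.symm c2, c1])
    · by_cases c2 : fh k g = []
      · refine Or.inr (Or.inl ⟨(h3 _).2 ⟨c1, g, hg, rfl⟩, c1, c2, ?_⟩)
        rintro u ⟨-, hu, g', hg', e, rfl⟩
        exact hu (by rw [← h5 g hg g' hg' e.symm c1, c2])
      · exact Or.inl ⟨⟨c1, c2, g, hg, rfl, rfl⟩, c1, c2⟩

noncomputable def QS (X Y : Finset W) : Finset (Finset W) := (MS X Y).image (glueSet X Y)

theorem mem_QS {k : ℕ} {X Y G : Finset W} (hX : Low k X) (hY : High k Y) :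
    G ∈ QS X Y ↔ QQ k X Y G := by
  unfold QS
  rw [Finset.mem_image]
  constructor
  · rintro ⟨Θ, h, rfl⟩
    exact glue_QQ hX hY h
  · intro h
    exact ⟨_, QQ_unglue_mem h, QQ_glue hX hY h⟩

theorem sum_QS {A : Type*} [AddCommMonoid A] {k : ℕ} {X Y : Finset W} (hX : Low k X)
    (hY : High k Y) (f : Finset W → A) :
    ∑ Θ ∈ MS X Y, f (glueSet X Y Θ) = ∑ G ∈ QS X Y, f G := by
  unfold QS
  rw [Finset.sum_image]
  intro Θ h Θ' h' e
  rw [← unglue_glue hX hY h, ← unglue_glue hX hY h', e]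


structure TT (m k : ℕ) (X Y Z G : Finset W) : Prop where
  ne : ∀ g ∈ G, g ≠ []
  dec : ∀ g ∈ G, fl m g ++ (fl k (fh m g) ++ fh k g) = g
  memX : ∀ x, x ∈ X ↔ x ≠ [] ∧ ∃ g ∈ G, fl m g = x
  memY : ∀ x, x ∈ Y ↔ x ≠ [] ∧ ∃ g ∈ G, fl k (fh m g) = x
  memZ : ∀ x, x ∈ Z ↔ x ≠ [] ∧ ∃ g ∈ G, fh k g = x
  injX : ∀ g ∈ G, ∀ g' ∈ G, fl m g = fl m g' → fl m g ≠ [] → g = g'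
  injY : ∀ g ∈ G, ∀ g' ∈ G, fl k (fh m g) = fl k (fh m g') → fl k (fh m g) ≠ [] → g = g'
  injZ : ∀ g ∈ G, ∀ g' ∈ G, fh k g = fh k g' → fh k g ≠ [] → g = g'

theorem fl_fl {m k : ℕ} (h : m ≤ k) (g : W) : fl m (fl k g) = fl m g := by
  unfold fl; rw [List.filter_filter]; apply List.filter_congr; intro x _
  simp only [← Bool.decide_and, decide_eq_decide]; omega
theorem fl_fl' {m k : ℕ} (h : m ≤ k) (g : W) : fl k (fl m g) = fl m g := by
  unfold fl; rw [List.filter_filter]; apply List.filter_congr; intro x _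
  simp only [← Bool.decide_and, decide_eq_decide]; omega
theorem fh_fh {m k : ℕ} (h : m ≤ k) (g : W) : fh k (fh m g) = fh k g := by
  unfold fh; rw [List.filter_filter]; apply List.filter_congr; intro x _
  simp only [← Bool.decide_and, decide_eq_decide]; omega
theorem fh_fh' {m k : ℕ} (h : m ≤ k) (g : W) : fh m (fh k g) = fh k g := by
  unfold fh; rw [List.filter_filter]; apply List.filter_congr; intro x _
  simp only [← Bool.decide_and, decide_eq_decide]; omega
theorem fh_fl (m k : ℕ) (g : W) : fh m (fl k g) = fl k (fh m g) := by
  unfold fh fl; rw [List.filter_comm]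
theorem fl_fh_nil {m k : ℕ} (h : m ≤ k) (g : W) : fl m (fh k g) = [] := by
  apply fl_high; intro y hy; simp [fh] at hy; omega
theorem fh_fl_nil {m k : ℕ} (h : m ≤ k) (g : W) : fh k (fl m g) = [] := by
  apply fh_low; intro y hy; simp [fl] at hy; omega
theorem fl_nil (k : ℕ) : fl k [] = [] := rfl
theorem fh_nil (k : ℕ) : fh k [] = [] := rfl

noncomputable def resL (k : ℕ) (G : Finset W) : Finset W := (G.image (fl k)).erase []
noncomputable def resH (k : ℕ) (G : Finset W) : Finset W := (G.image (fh k)).erase []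

theorem mem_resL {k : ℕ} {G : Finset W} {x : W} :
    x ∈ resL k G ↔ x ≠ [] ∧ ∃ g ∈ G, fl k g = x := by simp [resL]
theorem mem_resH {k : ℕ} {G : Finset W} {x : W} :
    x ∈ resH k G ↔ x ≠ [] ∧ ∃ g ∈ G, fh k g = x := by simp [resH]

theorem tri_left {m k : ℕ} (hmk : m ≤ k) {X Y Z H G : Finset W} :
    QQ m X Y H ∧ QQ k H Z G ↔ TT m k X Y Z G ∧ H = resL k G := by
  constructor
  · rintro ⟨h, g⟩
    have hH : H = resL k G := by ext x; rw [g.memX, mem_resL]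
    refine ⟨⟨g.ne, ?_, ?_, ?_, g.memY, ?_, ?_, g.injY⟩, hH⟩
    · intro a ha
      conv_rhs => rw [← g.dec a ha]
      rw [← List.append_assoc]
      congr 1
      by_cases c : fl k a = []
      · rw [← fl_fl hmk, ← fh_fl, c]; rfl
      · rw [← fl_fl hmk, ← fh_fl]
        exact h.dec _ ((g.memX _).2 ⟨c, a, ha, rfl⟩)
    · intro x
      rw [h.memX]
      refine and_congr_right fun hx => ⟨?_, ?_⟩
      · rintro ⟨b, hb, rfl⟩
        obtain ⟨-, a, ha, rfl⟩ := (g.memX _).1 hb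
        exact ⟨a, ha, (fl_fl hmk a).symm⟩
      · rintro ⟨a, ha, rfl⟩
        refine ⟨fl k a, (g.memX _).2 ⟨?_, a, ha, rfl⟩, fl_fl hmk a⟩
        intro c; rw [← fl_fl hmk, c] at hx; exact hx rfl
    · intro x
      rw [h.memY]
      refine and_congr_right fun hx => ⟨?_, ?_⟩
      · rintro ⟨b, hb, rfl⟩
        obtain ⟨-, a, ha, rfl⟩ := (g.memX _).1 hb
        exact ⟨a, ha, (fh_fl m k a).symm⟩
      · rintro ⟨a, ha, rfl⟩
        refine ⟨fl k a, (g.memX _).2 ⟨?_, a, ha, rfl⟩, fh_fl m k a⟩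
        intro c; rw [← fh_fl, c] at hx; exact hx rfl
    · intro a ha a' ha' e n
      have n1 : fl k a ≠ [] := by intro c; rw [← fl_fl hmk, c] at n; exact n rfl
      have n2 : fl k a' ≠ [] := by intro c; rw [e, ← fl_fl hmk, c] at n; exact n rfl
      refine g.injX a ha a' ha' ?_ n1
      refine h.injX _ ((g.memX _).2 ⟨n1, a, ha, rfl⟩) _ ((g.memX _).2 ⟨n2, a', ha', rfl⟩) ?_ ?_
      · rw [fl_fl hmk, fl_fl hmk, e]
      · rwa [fl_fl hmk]
    · intro a ha a' ha' e n
      have n1 : fl k a ≠ [] := by intro c; rw [← fh_fl, c] at n; exact n rfl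
      have n2 : fl k a' ≠ [] := by intro c; rw [e, ← fh_fl, c] at n; exact n rfl
      refine g.injX a ha a' ha' ?_ n1
      refine h.injY _ ((g.memX _).2 ⟨n1, a, ha, rfl⟩) _ ((g.memX _).2 ⟨n2, a', ha', rfl⟩) ?_ ?_
      · rw [fh_fl, fh_fl, e]
      · rwa [fh_fl]
  · rintro ⟨t, rfl⟩
    have d : ∀ a ∈ G, fl k a = fl m a ++ fl k (fh m a) := by
      intro a ha
      conv_lhs => rw [← t.dec a ha]
      rw [fl_append, fl_append, fl_fh_nil le_rfl, fl_fl' hmk, fl_fl le_rfl, List.append_nil]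
    have inj : ∀ g ∈ G, ∀ g' ∈ G, fl k g = fl k g' → fl k g ≠ [] → g = g' := by
      intro a ha a' ha' e n
      by_cases c : fl m a = []
      · refine t.injY a ha a' ha' ?_ ?_
        · rw [← fh_fl, ← fh_fl, e]
        · rw [d a ha, c] at n; simpa using n
      · refine t.injX a ha a' ha' ?_ c
        rw [← fl_fl hmk, e, fl_fl hmk]
    constructor
    · refine ⟨?_, ?_, ?_, ?_, ?_, ?_⟩
      · intro g hg; exact (mem_resL.1 hg).1
      · intro g hg
        obtain ⟨-, a, ha, rfl⟩ := mem_resL.1 hg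
        rw [fl_fl hmk, fh_fl, ← d a ha]
      · intro x
        rw [t.memX]
        refine and_congr_right fun hx => ⟨?_, ?_⟩
        · rintro ⟨a, ha, rfl⟩
          refine ⟨fl k a, mem_resL.2 ⟨?_, a, ha, rfl⟩, fl_fl hmk a⟩
          intro c; rw [← fl_fl hmk, c] at hx; exact hx rfl
        · rintro ⟨b, hb, rfl⟩
          obtain ⟨-, a, ha, rfl⟩ := mem_resL.1 hb
          exact ⟨a, ha, (fl_fl hmk a).symm⟩
      · intro x
        rw [t.memY]
        refine and_congr_right fun hx => ⟨?_, ?_⟩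
        · rintro ⟨a, ha, rfl⟩
          refine ⟨fl k a, mem_resL.2 ⟨?_, a, ha, rfl⟩, fh_fl m k a⟩
          intro c; rw [← fh_fl, c] at hx; exact hx rfl
        · rintro ⟨b, hb, rfl⟩
          obtain ⟨-, a, ha, rfl⟩ := mem_resL.1 hb
          exact ⟨a, ha, (fh_fl m k a).symm⟩
      · intro b hb b' hb' e n
        obtain ⟨-, a, ha, rfl⟩ := mem_resL.1 hb
        obtain ⟨-, a', ha', rfl⟩ := mem_resL.1 hb'
        rw [fl_fl hmk] at e n
        rw [fl_fl hmk] at e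
        rw [t.injX a ha a' ha' e n]
      · intro b hb b' hb' e n
        obtain ⟨-, a, ha, rfl⟩ := mem_resL.1 hb
        obtain ⟨-, a', ha', rfl⟩ := mem_resL.1 hb'
        rw [fh_fl] at e n
        rw [fh_fl] at e
        rw [t.injY a ha a' ha' e n]
    · refine ⟨t.ne, ?_, fun x => mem_resL, t.memZ, inj, t.injZ⟩
      intro a ha
      rw [d a ha, List.append_assoc, t.dec a ha]

theorem tri_right {m k : ℕ} (hmk : m ≤ k) {X Y Z H G : Finset W} :
    QQ k Y Z H ∧ QQ m X H G ↔ TT m k X Y Z G ∧ H = resH m G := by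
  constructor
  · rintro ⟨h, g⟩
    have hH : H = resH m G := by ext x; rw [g.memY, mem_resH]
    refine ⟨⟨g.ne, ?_, g.memX, ?_, ?_, g.injX, ?_, ?_⟩, hH⟩
    · intro a ha
      conv_rhs => rw [← g.dec a ha]
      congr 1
      by_cases c : fh m a = []
      · rw [← fh_fh hmk, c]; rfl
      · rw [← fh_fh hmk]
        exact h.dec _ ((g.memY _).2 ⟨c, a, ha, rfl⟩)
    · intro x
      rw [h.memX]
      refine and_congr_right fun hx => ⟨?_, ?_⟩
      · rintro ⟨b, hb, rfl⟩
        obtain ⟨-, a, ha, rfl⟩ := (g.memY _).1 hb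
        exact ⟨a, ha, rfl⟩
      · rintro ⟨a, ha, rfl⟩
        refine ⟨fh m a, (g.memY _).2 ⟨?_, a, ha, rfl⟩, rfl⟩
        intro c; rw [c] at hx; exact hx rfl
    · intro x
      rw [h.memY]
      refine and_congr_right fun hx => ⟨?_, ?_⟩
      · rintro ⟨b, hb, rfl⟩
        obtain ⟨-, a, ha, rfl⟩ := (g.memY _).1 hb
        exact ⟨a, ha, (fh_fh hmk a).symm⟩
      · rintro ⟨a, ha, rfl⟩
        refine ⟨fh m a, (g.memY _).2 ⟨?_, a, ha, rfl⟩, fh_fh hmk a⟩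
        intro c; rw [← fh_fh hmk, c] at hx; exact hx rfl
    · intro a ha a' ha' e n
      have n1 : fh m a ≠ [] := by intro c; rw [c] at n; exact n rfl
      have n2 : fh m a' ≠ [] := by intro c; rw [e, c] at n; exact n rfl
      refine g.injY a ha a' ha' ?_ n1
      exact h.injX _ ((g.memY _).2 ⟨n1, a, ha, rfl⟩) _ ((g.memY _).2 ⟨n2, a', ha', rfl⟩) e n
    · intro a ha a' ha' e n
      have n1 : fh m a ≠ [] := by intro c; rw [← fh_fh hmk, c] at n; exact n rfl
      have n2 : fh m a' ≠ [] := by intro c; rw [e, ← fh_fh hmk, c] at n; exact n rfl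
      refine g.injY a ha a' ha' ?_ n1
      refine h.injY _ ((g.memY _).2 ⟨n1, a, ha, rfl⟩) _ ((g.memY _).2 ⟨n2, a', ha', rfl⟩) ?_ ?_
      · rw [fh_fh hmk, fh_fh hmk, e]
      · rwa [fh_fh hmk]
  · rintro ⟨t, rfl⟩
    have d : ∀ a ∈ G, fh m a = fl k (fh m a) ++ fh k a := by
      intro a ha
      conv_lhs => rw [← t.dec a ha]
      rw [fh_append, fh_append, fh_fl_nil le_rfl, fh_fl, fh_fh le_rfl, fh_fh' hmk, List.nil_append]
    have inj : ∀ g ∈ G, ∀ g' ∈ G, fh m g = fh m g' → fh m g ≠ [] → g = g' := by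
      intro a ha a' ha' e n
      by_cases c : fl k (fh m a) = []
      · refine t.injZ a ha a' ha' ?_ ?_
        · rw [← fh_fh hmk, e, fh_fh hmk]
        · rw [d a ha, c] at n; simpa using n
      · refine t.injY a ha a' ha' ?_ c
        rw [e]
    constructor
    · refine ⟨?_, ?_, ?_, ?_, ?_, ?_⟩
      · intro g hg; exact (mem_resH.1 hg).1
      · intro g hg
        obtain ⟨-, a, ha, rfl⟩ := mem_resH.1 hg
        rw [fh_fh hmk, ← d a ha]
      · intro x
        rw [t.memY]
        refine and_congr_right fun hx => ⟨?_, ?_⟩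
        · rintro ⟨a, ha, rfl⟩
          refine ⟨fh m a, mem_resH.2 ⟨?_, a, ha, rfl⟩, rfl⟩
          intro c; rw [c] at hx; exact hx rfl
        · rintro ⟨b, hb, rfl⟩
          obtain ⟨-, a, ha, rfl⟩ := mem_resH.1 hb
          exact ⟨a, ha, rfl⟩
      · intro x
        rw [t.memZ]
        refine and_congr_right fun hx => ⟨?_, ?_⟩
        · rintro ⟨a, ha, rfl⟩
          refine ⟨fh m a, mem_resH.2 ⟨?_, a, ha, rfl⟩, fh_fh hmk a⟩
          intro c; rw [← fh_fh hmk, c] at hx; exact hx rfl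
        · rintro ⟨b, hb, rfl⟩
          obtain ⟨-, a, ha, rfl⟩ := mem_resH.1 hb
          exact ⟨a, ha, (fh_fh hmk a).symm⟩
      · intro b hb b' hb' e n
        obtain ⟨-, a, ha, rfl⟩ := mem_resH.1 hb
        obtain ⟨-, a', ha', rfl⟩ := mem_resH.1 hb'
        rw [t.injY a ha a' ha' e n]
      · intro b hb b' hb' e n
        obtain ⟨-, a, ha, rfl⟩ := mem_resH.1 hb
        obtain ⟨-, a', ha', rfl⟩ := mem_resH.1 hb'
        rw [fh_fh hmk] at e n
        rw [fh_fh hmk] at e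
        rw [t.injZ a ha a' ha' e n]
    · refine ⟨t.ne, ?_, t.memX, fun x => mem_resH, t.injX, inj⟩
      intro a ha
      rw [d a ha, t.dec a ha]

noncomputable def shS (m : ℕ) (H : Finset W) : Finset W := H.image (shiftW m)

theorem shiftW_inj (m : ℕ) : Function.Injective (shiftW m) :=
  List.map_injective_iff.2 (add_left_injective m)
theorem shiftW_nil {m : ℕ} {g : W} : shiftW m g = [] ↔ g = [] := by simp [shiftW]
theorem fl_shift (m k : ℕ) (g : W) : fl (m + k) (shiftW m g) = shiftW m (fl k g) := by
  unfold fl shiftW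
  rw [List.filter_map]
  congr 1
  apply List.filter_congr; intro x _
  simp only [Function.comp, decide_eq_decide]; omega
theorem fh_shift (m k : ℕ) (g : W) : fh (m + k) (shiftW m g) = shiftW m (fh k g) := by
  unfold fh shiftW
  rw [List.filter_map]
  congr 1
  apply List.filter_congr; intro x _
  simp only [Function.comp, decide_eq_decide]; omega
theorem shS_inj (m : ℕ) : Function.Injective (shS m) := Finset.image_injective (shiftW_inj m)

theorem mem_shS {m : ℕ} {H : Finset W} {x : W} : x ∈ shS m H ↔ ∃ g ∈ H, shiftW m g = x := by
  simp [shS]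
theorem mem_shS' {m : ℕ} {H : Finset W} {x : W} : shiftW m x ∈ shS m H ↔ x ∈ H := by
  rw [mem_shS]; constructor
  · rintro ⟨g, hg, e⟩; rwa [← shiftW_inj m e]
  · intro h; exact ⟨x, h, rfl⟩

theorem QQ_shift {m k : ℕ} {Y Z H : Finset W} :
    QQ (m + k) (shS m Y) (shS m Z) (shS m H) ↔ QQ k Y Z H := by
  have inj := shiftW_inj m
  constructor
  · rintro ⟨h1, h2, h3, h4, h5, h6⟩
    refine ⟨?_, ?_, ?_, ?_, ?_, ?_⟩
    · intro g hg e; exact h1 _ (mem_shS'.2 hg) (shiftW_nil.2 e)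
    · intro g hg; apply inj; have := h2 _ (mem_shS'.2 hg)
      rw [fl_shift, fh_shift] at this; rw [← this]; simp [shiftW]
    · intro x
      have := h3 (shiftW m x)
      rw [mem_shS'] at this
      simp only [mem_shS, exists_exists_and_eq_and, fl_shift, inj.eq_iff, ne_eq,
        shiftW_nil] at this
      exact this
    · intro x
      have := h4 (shiftW m x)
      rw [mem_shS'] at this
      simp only [mem_shS, exists_exists_and_eq_and, fh_shift, inj.eq_iff, ne_eq,
        shiftW_nil] at this
      exact this
    · intro g hg g' hg' e n
      apply inj
      apply h5 _ (mem_shS'.2 hg) _ (mem_shS'.2 hg') <;> simp [fl_shift, shiftW_nil, e]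
      rwa [← e]
    · intro g hg g' hg' e n
      apply inj
      apply h6 _ (mem_shS'.2 hg) _ (mem_shS'.2 hg') <;> simp [fh_shift, shiftW_nil, e]
      rwa [← e]
  · rintro ⟨h1, h2, h3, h4, h5, h6⟩
    refine ⟨?_, ?_, ?_, ?_, ?_, ?_⟩
    · intro g hg e; rw [mem_shS] at hg
      obtain ⟨g, hg, rfl⟩ := hg
      exact h1 _ hg (shiftW_nil.1 e)
    · intro g hg; rw [mem_shS] at hg
      obtain ⟨g, hg, rfl⟩ := hg
      rw [fl_shift, fh_shift]; conv_rhs => rw [← h2 g hg]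
      simp [shiftW]
    · intro x
      simp only [mem_shS, exists_exists_and_eq_and, fl_shift]
      constructor
      · rintro ⟨y, hy, rfl⟩
        obtain ⟨n, g, hg, rfl⟩ := (h3 y).1 hy
        exact ⟨fun e => n (shiftW_nil.1 e), g, hg, rfl⟩
      · rintro ⟨n, g, hg, rfl⟩
        exact ⟨fl k g, (h3 _).2 ⟨fun e => n (shiftW_nil.2 e), g, hg, rfl⟩, rfl⟩
    · intro x
      simp only [mem_shS, exists_exists_and_eq_and, fh_shift]
      constructor
      · rintro ⟨y, hy, rfl⟩
        obtain ⟨n, g, hg, rfl⟩ := (h4 y).1 hy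
        exact ⟨fun e => n (shiftW_nil.1 e), g, hg, rfl⟩
      · rintro ⟨n, g, hg, rfl⟩
        exact ⟨fh k g, (h4 _).2 ⟨fun e => n (shiftW_nil.2 e), g, hg, rfl⟩, rfl⟩
    · intro g hg g' hg' e n
      rw [mem_shS] at hg
      obtain ⟨g, hg, rfl⟩ := hg
      rw [mem_shS] at hg'
      obtain ⟨g', hg', rfl⟩ := hg'
      rw [fl_shift] at e n
      rw [fl_shift] at e
      rw [h5 g hg g' hg' (inj e) (fun e => n (shiftW_nil.2 e))]
    · intro g hg g' hg' e n
      rw [mem_shS] at hg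
      obtain ⟨g, hg, rfl⟩ := hg
      rw [mem_shS] at hg'
      obtain ⟨g', hg', rfl⟩ := hg'
      rw [fh_shift] at e n
      rw [fh_shift] at e
      rw [h6 g hg g' hg' (inj e) (fun e => n (shiftW_nil.2 e))]

noncomputable def unS (m : ℕ) (H : Finset W) : Finset W := H.image (List.map (· - m))

theorem unS_shS (m : ℕ) (H : Finset W) : unS m (shS m H) = H := by
  unfold unS shS
  rw [Finset.image_image]
  have : (List.map (· - m) ∘ shiftW m) = id := by
    funext g; simp [shiftW, Function.comp_def]
  rw [this, Finset.image_id]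

theorem shS_unS_resH (m : ℕ) (G : Finset W) : shS m (unS m (resH m G)) = resH m G := by
  unfold unS shS
  rw [Finset.image_image]
  conv_rhs => rw [← Finset.image_id (s := resH m G)]
  apply Finset.image_congr
  intro x hx
  obtain ⟨-, g, -, rfl⟩ := mem_resH.1 (Finset.mem_coe.1 hx)
  simp only [shiftW, Function.comp, List.map_map, id]
  conv_rhs => rw [← List.map_id (fh m g)]
  apply List.map_congr_left
  intro y hy
  simp [fh] at hy ⊢
  omega

theorem QQ_low {m k : ℕ} (hmk : m ≤ k) {X Y H : Finset W} (hX : Low m X) (hY : Low k Y)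
    (h : QQ m X Y H) : Low k H := by
  intro g hg
  refine ⟨h.ne g hg, fun y hy => ?_⟩
  rw [← h.dec g hg, List.mem_append] at hy
  rcases hy with hy | hy
  · simp [fl] at hy; omega
  · exact (hY (fh m g) ((h.memY _).2 ⟨List.ne_nil_of_mem hy, g, hg, rfl⟩)).2 y hy

theorem shS_high {m : ℕ} {H : Finset W} (h : High 0 H) : High m (shS m H) := by
  intro g hg
  rw [mem_shS] at hg
  obtain ⟨g, hg, rfl⟩ := hg
  refine ⟨fun e => (h g hg).1 (shiftW_nil.1 e), fun y hy => ?_⟩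
  simp only [shiftW, List.mem_map] at hy
  obtain ⟨z, hz, rfl⟩ := hy
  have := (h g hg).2 z hz
  omega
theorem shS_low {m n : ℕ} {H : Finset W} (h : Low n H) : Low (m + n) (shS m H) := by
  intro g hg
  rw [mem_shS] at hg
  obtain ⟨g, hg, rfl⟩ := hg
  refine ⟨fun e => (h g hg).1 (shiftW_nil.1 e), fun y hy => ?_⟩
  simp only [shiftW, List.mem_map] at hy
  obtain ⟨z, hz, rfl⟩ := hy
  have := (h g hg).2 z hz
  omega
theorem shS_shS (m n : ℕ) (H : Finset W) : shS m (shS n H) = shS (m + n) H := by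
  unfold shS
  rw [Finset.image_image]
  congr 1
  funext g
  simp [shiftW]
  intros; omega

theorem QQ_pos {k : ℕ} {Y Z H : Finset W} (hY : High 0 Y) (hZ : High 0 Z)
    (h : QQ k Y Z H) : High 0 H := by
  intro g hg
  refine ⟨h.ne g hg, fun y hy => ?_⟩
  rw [← h.dec g hg, List.mem_append] at hy
  rcases hy with hy | hy
  · exact (hY (fl k g) ((h.memX _).2 ⟨List.ne_nil_of_mem hy, g, hg, rfl⟩)).2 y hy
  · exact (hZ (fh k g) ((h.memY _).2 ⟨List.ne_nil_of_mem hy, g, hg, rfl⟩)).2 y hy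

theorem main_sum {A : Type*} [AddCommMonoid A] {m n : ℕ} {X Y Z : Finset W}
    (hX : Low m X) (hY : Low n Y) (hY0 : High 0 Y) (hZ0 : High 0 Z) (f : Finset W → A) :
    ∑ H ∈ QS X (shS m Y), ∑ G ∈ QS H (shS (m + n) Z), f G =
    ∑ H ∈ QS Y (shS n Z), ∑ G ∈ QS X (shS m H), f G := by
  have hmk : m ≤ m + n := Nat.le_add_right _ _
  have L : ∀ H G, (H ∈ QS X (shS m Y) ∧ G ∈ QS H (shS (m + n) Z)) ↔
      TT m (m + n) X (shS m Y) (shS (m + n) Z) G ∧ H = resL (m + n) G := by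
    intro H G
    rw [← tri_left hmk, mem_QS hX (shS_high hY0)]
    refine and_congr_right fun h => ?_
    rw [mem_QS (QQ_low hmk hX (shS_low hY) h) (shS_high hZ0)]
  have R : ∀ H G, (H ∈ QS Y (shS n Z) ∧ G ∈ QS X (shS m H)) ↔
      TT m (m + n) X (shS m Y) (shS (m + n) Z) G ∧ shS m H = resH m G := by
    intro H G
    rw [← tri_right hmk, mem_QS hY (shS_high hZ0), ← shS_shS, QQ_shift]
    refine and_congr_right fun h => ?_
    have hz : High 0 (shS n Z) := fun x hx =>
      ⟨(shS_high hZ0 x hx).1, fun y hy => Nat.zero_lt_of_lt ((shS_high hZ0 x hx).2 y hy)⟩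
    rw [mem_QS hX (shS_high (QQ_pos hY0 hz h))]
  rw [Finset.sum_sigma', Finset.sum_sigma']
  refine Finset.sum_nbij' (fun p => ⟨unS m (resH m p.2), p.2⟩) (fun p => ⟨resL (m + n) p.2, p.2⟩)
    ?_ ?_ ?_ ?_ ?_
  · rintro ⟨H, G⟩ h
    simp only [Finset.mem_sigma] at h ⊢
    rw [R]
    exact ⟨((L _ _).1 h).1, shS_unS_resH _ _⟩
  · rintro ⟨H, G⟩ h
    simp only [Finset.mem_sigma] at h ⊢
    rw [L]
    exact ⟨((R _ _).1 h).1, rfl⟩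
  · rintro ⟨H, G⟩ h
    simp only [Finset.mem_sigma] at h ⊢
    rw [((L _ _).1 h).2]
  · rintro ⟨H, G⟩ h
    simp only [Finset.mem_sigma] at h ⊢
    rw [← ((R _ _).1 h).2, unS_shS]
  · intros; rfl

theorem segs_nil : segs [] = [] := by rw [segs]
theorem segs_cons (x : ℕ) (xs : W) : segs (x :: xs) =
    (x :: xs.takeWhile fun y => x ≤ y) :: segs (xs.dropWhile fun y => x ≤ y) := by rw [segs]

theorem segs_flatten (a : W) : (segs a).flatten = a := by
  induction h : a.length using Nat.strong_induction_on generalizing a with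
  | _ n ih =>
    cases a with
    | nil => rw [segs_nil]; rfl
    | cons x xs =>
      rw [segs_cons, List.flatten_cons, ih _ _ _ rfl, List.cons_append,
        List.takeWhile_append_dropWhile]
      rw [← h]
      exact Nat.lt_succ_of_le (List.dropWhile_sublist _).length_le

/-- decreasing heads, all dominated -/
def GoodL (L : List W) : Prop :=
  (∀ w ∈ L, Dominated w) ∧ L.Pairwise (fun u v => v.headD 0 < u.headD 0)

theorem segs_good (a : W) : GoodL (segs a) ∧ ∀ w ∈ segs a, w.headD 0 ≤ a.headD 0 := by
  induction h : a.length using Nat.strong_induction_on generalizing a with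
  | _ n ih =>
    cases a with
    | nil => rw [segs_nil]; simp [GoodL]
    | cons x xs =>
      obtain ⟨⟨h1, h2⟩, h3⟩ := ih _ (by
        rw [← h]
        exact Nat.lt_succ_of_le (List.dropWhile_sublist (fun y => decide (x ≤ y))).length_le)
          (xs.dropWhile fun y => decide (x ≤ y)) rfl
      have h4 : ∀ w ∈ segs (xs.dropWhile fun y => decide (x ≤ y)), w.headD 0 < x := by
        intro w hw
        refine lt_of_le_of_lt (h3 w hw) ?_
        cases hd : (xs.dropWhile fun y => decide (x ≤ y)) with
        | nil => rw [hd, segs_nil] at hw; simp at hw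
        | cons y ys =>
          have := List.head_dropWhile_not (fun y => decide (x ≤ y)) (l := xs) (by rw [hd]; simp)
          simp only [hd, List.head_cons] at this
          simpa using this
      rw [segs_cons]
      refine ⟨⟨?_, ?_⟩, ?_⟩
      · intro w hw
        rcases List.mem_cons.1 hw with rfl | hw
        · refine ⟨by simp, ?_⟩
          intro z hz
          rcases List.mem_cons.1 hz with rfl | hz
          · simp
          · have := List.mem_takeWhile_imp hz
            simpa using this
        · exact h1 w hw
      · rw [List.pairwise_cons]
        exact ⟨fun w hw => by simpa using h4 w hw, h2⟩
      · intro w hw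
        rcases List.mem_cons.1 hw with rfl | hw
        · simp
        · simpa using (h4 w hw).le

theorem segs_of_good (L : List W) (h : GoodL L) : segs L.flatten = L := by
  induction L with
  | nil => rw [List.flatten_nil, segs_nil]
  | cons w L ih =>
    obtain ⟨h1, h2⟩ := h
    rw [List.pairwise_cons] at h2
    obtain ⟨h2, h3⟩ := h2
    have ih := ih ⟨fun w hw => h1 w (List.mem_cons_of_mem _ hw), h3⟩
    obtain ⟨hw, hw'⟩ := h1 w List.mem_cons_self
    cases w with
    | nil => exact absurd rfl hw
    | cons x xs =>
      have hxs : ∀ y ∈ xs, decide (x ≤ y) = true := by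
        intro y hy
        simpa using hw' y (List.mem_cons_of_mem _ hy)
      have ht : L.flatten = [] ∨ ∃ y ys, L.flatten = y :: ys ∧ y < x := by
        cases L with
        | nil => left; rfl
        | cons v L =>
          right
          obtain ⟨hv, -⟩ := h1 v (by simp)
          have hv2 := h2 v (by simp)
          cases v with
          | nil => exact absurd rfl hv
          | cons y ys => exact ⟨y, ys ++ L.flatten, by simp, by simpa using hv2⟩
      rw [List.flatten_cons, List.cons_append, segs_cons,
        List.takeWhile_append_of_pos hxs, List.dropWhile_append_of_pos hxs]
      rcases ht with ht | ⟨y, ys, ht, hy⟩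
      · rw [ht] at ih ⊢
        simp [ih]
      · rw [ht] at ih ⊢
        have : decide (x ≤ y) = false := by simpa using hy
        rw [List.takeWhile_cons_of_neg (by simp [this]), List.dropWhile_cons_of_neg (by simp [this])]
        simp [ih]

noncomputable def FF (a : W) : Finset W := (LR a).toFinset

theorem mem_FF {a w : W} : w ∈ FF a ↔ w ∈ segs a := by simp [FF, LR]

def Good (G : Finset W) : Prop :=
  (∀ g ∈ G, Dominated g) ∧ ∀ g ∈ G, ∀ g' ∈ G, g.headD 0 = g'.headD 0 → g = g'

theorem lt_of_head {u v : W} (hu : u ≠ []) (hv : v ≠ []) (h : u.headD 0 < v.headD 0) : u < v := by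
  cases u with
  | nil => exact absurd rfl hu
  | cons x xs =>
    cases v with
    | nil => exact absurd rfl hv
    | cons y ys => exact List.Lex.rel (by simpa using h)

theorem good_FF (a : W) : Good (FF a) := by
  obtain ⟨⟨h1, h2⟩, -⟩ := segs_good a
  refine ⟨fun g hg => h1 g (mem_FF.1 hg), ?_⟩
  intro g hg g' hg' e
  rw [mem_FF] at hg hg'
  by_contra hne
  have p1 : (segs a).Pairwise (fun u v : W => u ≠ v → u.headD 0 ≠ v.headD 0) :=
    by
    refine h2.imp ?_
    intro u v h _
    exact ne_of_gt h
  have p2 : (segs a).Pairwise (flip (fun u v : W => u ≠ v → u.headD 0 ≠ v.headD 0)) :=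
    by
    refine h2.imp ?_
    intro u v h _
    exact ne_of_lt h
  have := List.Pairwise.forall_of_forall_of_flip (fun x _ h => absurd rfl h) p1 p2 hg hg'
  exact this hne e

theorem word_FF (a : W) : wordOfSet (FF a) = a := by
  obtain ⟨⟨h1, h2⟩, -⟩ := segs_good a
  have hp : (LR a).Pairwise (fun u v => u < v) := by
    unfold LR
    rw [List.pairwise_reverse]
    refine h2.imp_of_mem ?_
    intro u v hu hv h
    exact lt_of_head (h1 v hv).1 (h1 u hu).1 h
  have hs : (FF a).sort (· ≤ ·) = LR a := by
    unfold FF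
    rw [List.toFinset_sort]
    · exact hp.imp le_of_lt
    · exact hp.imp ne_of_lt
  unfold wordOfSet
  rw [hs, LR, List.reverse_reverse, segs_flatten]

theorem FF_word {G : Finset W} (h : Good G) : FF (wordOfSet G) = G := by
  unfold FF LR wordOfSet
  rw [segs_of_good, List.reverse_reverse, Finset.sort_toFinset]
  refine ⟨fun w hw => h.1 w (by simpa using hw), ?_⟩
  rw [List.pairwise_reverse]
  have := (Finset.sortedLT_sort G).pairwise
  refine this.imp_of_mem ?_
  intro u v hu hv huv
  rw [Finset.mem_sort] at hu hv
  by_contra hc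
  rcases (not_lt.1 hc).lt_or_eq with hc | hc
  · exact lt_asymm huv (lt_of_head (h.1 v hv).1 (h.1 u hu).1 hc)
  · exact ne_of_lt huv (h.2 u hu v hv hc.symm)

theorem headD_mem {g : W} (h : g ≠ []) : g.headD 0 ∈ g := by
  cases g with
  | nil => exact absurd rfl h
  | cons x xs => simp

theorem QQ_good {k : ℕ} {X Y G : Finset W} (hX : Good X) (hY : Good Y) (h : QQ k X Y G) :
    Good G := by
  have hl : ∀ g ∈ G, fl k g ≠ [] → g.headD 0 = (fl k g).headD 0 := by
    intro g hg n
    conv_lhs => rw [← h.dec g hg]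
    cases hc : fl k g with
    | nil => exact absurd hc n
    | cons x xs => simp
  have hh : ∀ g ∈ G, fl k g = [] → fh k g = g := by
    intro g hg e
    conv_rhs => rw [← h.dec g hg]
    simp [e]
  have flle : ∀ g, ∀ x ∈ fl k g, x ≤ k := by intro g x hx; simp [fl] at hx; omega
  have fhlt : ∀ g, ∀ x ∈ fh k g, k < x := by intro g x hx; simp [fh] at hx; omega
  refine ⟨?_, ?_⟩
  · intro g hg
    refine ⟨h.ne g hg, fun x hx => ?_⟩
    by_cases c : fl k g = []
    · have e := hh g hg c
      have := hY.1 (fh k g) ((h.memY _).2 ⟨by rw [e]; exact h.ne g hg, g, hg, rfl⟩)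
      rw [e] at this
      exact this.2 x hx
    · have := hX.1 (fl k g) ((h.memX _).2 ⟨c, g, hg, rfl⟩)
      rw [hl g hg c]
      rw [← h.dec g hg, List.mem_append] at hx
      rcases hx with hx | hx
      · exact this.2 x hx
      · have h1 := flle g _ (headD_mem c)
        have h2 := fhlt g x hx
        omega
  · intro g hg g' hg' e
    by_cases c : fl k g = [] <;> by_cases c' : fl k g' = []
    · have e1 := hh g hg c
      have e2 := hh g' hg' c'
      refine hY.2 g ?_ g' ?_ e
      · exact (h.memY _).2 ⟨h.ne g hg, g, hg, e1⟩
      · exact (h.memY _).2 ⟨h.ne g' hg', g', hg', e2⟩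
    · exfalso
      have e1 := hh g hg c
      rw [hl g' hg' c'] at e
      have h1 := flle g' _ (headD_mem c')
      have h2 := fhlt g (g.headD 0) (by rw [e1]; exact headD_mem (h.ne g hg))
      omega
    · exfalso
      have e1 := hh g' hg' c'
      rw [hl g hg c] at e
      have h1 := flle g _ (headD_mem c)
      have h2 := fhlt g' (g'.headD 0) (by rw [e1]; exact headD_mem (h.ne g' hg'))
      omega
    · rw [hl g hg c, hl g' hg' c'] at e
      refine h.injX g hg g' hg' ?_ c
      exact hX.2 _ ((h.memX _).2 ⟨c, g, hg, rfl⟩) _ ((h.memX _).2 ⟨c', g', hg', rfl⟩) e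

theorem shS_good {m : ℕ} {G : Finset W} (h : Good G) : Good (shS m G) := by
  have hd : ∀ g : W, g ≠ [] → (shiftW m g).headD 0 = g.headD 0 + m := by
    intro g hg
    cases g with
    | nil => exact absurd rfl hg
    | cons x xs => simp [shiftW]
  refine ⟨?_, ?_⟩
  · intro g hg
    rw [mem_shS] at hg
    obtain ⟨g, hg, rfl⟩ := hg
    obtain ⟨h1, h2⟩ := h.1 g hg
    refine ⟨fun e => h1 (shiftW_nil.1 e), fun x hx => ?_⟩
    rw [hd g h1]
    simp only [shiftW, List.mem_map] at hx
    obtain ⟨y, hy, rfl⟩ := hx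
    have := h2 y hy
    omega
  · intro g hg g' hg' e
    rw [mem_shS] at hg hg'
    obtain ⟨g, hg, rfl⟩ := hg
    obtain ⟨g', hg', rfl⟩ := hg'
    rw [hd g (h.1 g hg).1, hd g' (h.1 g' hg').1] at e
    rw [h.2 g hg g' hg' (by omega)]

/-- The multiset of letters of a set of words. -/
noncomputable def msum (G : Finset W) : Multiset ℕ := ∑ g ∈ G, (g : Multiset ℕ)

theorem coe_flatten (L : List W) :
    ((L.flatten : W) : Multiset ℕ) = (L.map (fun g : W => (g : Multiset ℕ))).sum := by
  induction L with
  | nil => rfl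
  | cons w L ih => rw [List.flatten_cons, ← Multiset.coe_add, ih, List.map_cons, List.sum_cons]

theorem coe_word (G : Finset W) : ((wordOfSet G : W) : Multiset ℕ) = msum G := by
  unfold wordOfSet msum
  rw [coe_flatten, List.map_reverse, List.sum_reverse, Finset.sum, ← Finset.sort_eq G (· ≤ ·),
    Multiset.map_coe, Multiset.sum_coe]

theorem msum_QQ {k : ℕ} {X Y G : Finset W} (h : QQ k X Y G) : msum G = msum X + msum Y := by
  have eX : X = (G.filter (fun g => fl k g ≠ [])).image (fl k) := by
    ext x; rw [h.memX]; simp only [Finset.mem_image, Finset.mem_filter]; grind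
  have eY : Y = (G.filter (fun g => fh k g ≠ [])).image (fh k) := by
    ext x; rw [h.memY]; simp only [Finset.mem_image, Finset.mem_filter]; grind
  have sX : msum X = ∑ g ∈ G, (fl k g : Multiset ℕ) := by
    unfold msum
    rw [eX, Finset.sum_image, Finset.sum_filter_of_ne]
    · intro x _ hx e; rw [e] at hx; exact hx rfl
    · intro g hg g' hg' e
      simp only [Finset.coe_filter, Set.mem_setOf_eq] at hg hg'
      exact h.injX g hg.1 g' hg'.1 e hg.2
  have sY : msum Y = ∑ g ∈ G, (fh k g : Multiset ℕ) := by
    unfold msum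
    rw [eY, Finset.sum_image, Finset.sum_filter_of_ne]
    · intro x _ hx e; rw [e] at hx; exact hx rfl
    · intro g hg g' hg' e
      simp only [Finset.coe_filter, Set.mem_setOf_eq] at hg hg'
      exact h.injY g hg.1 g' hg'.1 e hg.2
  rw [sX, sY, ← Finset.sum_add_distrib, msum]
  apply Finset.sum_congr rfl
  intro g hg
  rw [Multiset.coe_add, h.dec g hg]

theorem msum_FF (a : W) : msum (FF a) = a := by rw [← coe_word, word_FF]

theorem msum_shS (m : ℕ) (G : Finset W) : msum (shS m G) = (msum G).map (· + m) := by
  unfold msum shS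
  rw [Finset.sum_image (fun _ _ _ _ e => shiftW_inj m e)]
  have := map_sum (Multiset.mapAddMonoidHom (fun x : ℕ => x + m)) (fun g : W => (g : Multiset ℕ)) G
  simp only [Multiset.coe_mapAddMonoidHom] at this
  rw [this]
  rfl

theorem PF_le {a : W} (h : IsPF a) : ∀ x ∈ a, x ≤ a.length := by
  intro x hx
  rw [← List.mem_insertionSort (· ≤ ·)] at hx
  obtain ⟨i, hi, rfl⟩ := List.mem_iff_getElem.1 hx
  rw [List.length_insertionSort] at hi
  have := h.2 i hi
  rw [List.getD_eq_getElem _ _ (by rwa [List.length_insertionSort])] at this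
  omega

theorem low_FF {a : W} (h : IsPF a) : Low a.length (FF a) := by
  intro g hg
  refine ⟨((good_FF a).1 g hg).1, fun y hy => PF_le h y ?_⟩
  rw [← segs_flatten a]
  exact List.mem_flatten.2 ⟨g, mem_FF.1 hg, hy⟩

theorem high_FF {a : W} (h : IsPF a) : High 0 (FF a) := by
  intro g hg
  refine ⟨((good_FF a).1 g hg).1, fun y hy => h.1 y ?_⟩
  rw [← segs_flatten a]
  exact List.mem_flatten.2 ⟨g, mem_FF.1 hg, hy⟩

theorem PF_perm {a b : W} (h : IsPF a) (e : a.Perm b) : IsPF b := by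
  refine ⟨fun x hx => h.1 x (e.mem_iff.2 hx), fun i hi => ?_⟩
  have : b.insertionSort (· ≤ ·) = a.insertionSort (· ≤ ·) := by
    apply List.Perm.eq_of_sortedLE List.sortedLE_insertionSort List.sortedLE_insertionSort
    exact (List.perm_insertionSort _ _).trans (e.symm.trans (List.perm_insertionSort _ _).symm)
  rw [this]
  exact h.2 i (by rwa [e.length_eq])

theorem PF_shift {a b : W} (ha : IsPF a) (hb : IsPF b) : IsPF (a ++ shiftW a.length b) := by
  refine ⟨?_, ?_⟩
  · intro x hx
    rcases List.mem_append.1 hx with hx | hx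
    · exact ha.1 x hx
    · simp only [shiftW, List.mem_map] at hx
      obtain ⟨y, hy, rfl⟩ := hx
      have := hb.1 y hy
      omega
  · have e : (a ++ shiftW a.length b).insertionSort (· ≤ ·) =
        a.insertionSort (· ≤ ·) ++ shiftW a.length (b.insertionSort (· ≤ ·)) := by
      refine List.Perm.eq_of_pairwise (fun x y _ _ h1 h2 => le_antisymm h1 h2)
        (List.pairwise_insertionSort _ _) ?_ ?_
      · rw [List.pairwise_append]
        refine ⟨List.pairwise_insertionSort _ _, ?_, ?_⟩
        · unfold shiftW
          rw [List.pairwise_map]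
          exact (List.pairwise_insertionSort (· ≤ ·) b).imp (fun h => by omega)
        · intro x hx y hy
          rw [List.mem_insertionSort] at hx
          simp only [shiftW, List.mem_map] at hy
          obtain ⟨z, hz, rfl⟩ := hy
          have := PF_le ha x hx
          omega
      · refine (List.perm_insertionSort _ _).trans ?_
        exact (List.perm_insertionSort _ _).symm.append
          ((List.perm_insertionSort _ _).symm.map _)
    rw [e]
    intro i hi
    simp only [List.length_append, shiftW, List.length_map] at hi
    by_cases c : i < a.length
    · rw [List.getD_append _ _ _ _ (by rwa [List.length_insertionSort])]
      exact ha.2 i c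
    · rw [List.getD_append_right _ _ _ _ (by rw [List.length_insertionSort]; omega),
        List.length_insertionSort]
      have hj : i - a.length < b.length := by omega
      have := hb.2 _ hj
      have hj' : i - a.length < (b.insertionSort (· ≤ ·)).length := by
        rwa [List.length_insertionSort]
      rw [List.getD_eq_getElem _ _ hj'] at this
      rw [List.getD_eq_getElem _ _ (by simpa [shiftW] using hj)]
      simp only [shiftW, List.getElem_map]
      omega

theorem shiftF_toFinset (m : ℕ) (b : W) : (shiftF m (LR b)).toFinset = shS m (FF b) := by
  ext x
  rw [mem_shS]
  simp [shiftF, FF]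

theorem Rset_eq (a b : W) : Rset a b = MS (FF a) (shS a.length (FF b)) := by
  rw [← shiftF_toFinset]; rfl

theorem mTheta_eq (a b : W) (Θ : Finset (W × W)) :
    mTheta a b Θ = wordOfSet (glueSet (FF a) (shS a.length (FF b)) Θ) := by
  rw [← shiftF_toFinset]; rfl

theorem word_perm {a b : W} {G : Finset W} (h : QQ a.length (FF a) (shS a.length (FF b)) G) :
    (wordOfSet G).Perm (a ++ shiftW a.length b) := by
  rw [← Multiset.coe_eq_coe, coe_word, msum_QQ h, msum_FF, msum_shS, msum_FF]
  rfl

theorem mul_sum (K : Type) [Field K] {a b : W} (ha : IsPF a) (hb : IsPF b) :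
    mulSingle K a b = ∑ G ∈ QS (FF a) (shS a.length (FF b)), Mb K (wordOfSet G) := by
  unfold mulSingle
  rw [← sum_QS (low_FF ha) (shS_high (high_FF hb)) (fun G => Mb K (wordOfSet G)), Rset_eq]
  apply Finset.sum_congr rfl
  intro Θ _
  rw [mTheta_eq]

theorem star_single (K : Type) [Field K] (a b : W) :
    starF K (Mb K a) (Mb K b) = mulSingle K a b := by
  unfold starF Mb
  rw [Finsupp.sum_single_index, Finsupp.sum_single_index] <;> simp

theorem star_add_left (K : Type) [Field K] (x x' y : FW K) :
    starF K (x + x') y = starF K x y + starF K x' y := by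
  unfold starF
  rw [Finsupp.sum_add_index']
  · intro a; simp
  · intro a c c'
    simp [add_mul, add_smul, Finsupp.sum_add]

theorem star_add_right (K : Type) [Field K] (x y y' : FW K) :
    starF K x (y + y') = starF K x y + starF K x y' := by
  unfold starF
  rw [← Finsupp.sum_add]
  congr 1
  funext a c
  rw [Finsupp.sum_add_index']
  · intro a; simp
  · intro a c c'
    simp [mul_add, add_smul]

theorem star_sum_left (K : Type) [Field K] {ι : Type*} (s : Finset ι) (f : ι → FW K) (y : FW K) :
    starF K (∑ i ∈ s, f i) y = ∑ i ∈ s, starF K (f i) y := by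
  induction s using Finset.induction_on with
  | empty => simp [starF]
  | insert i s hi ih => rw [Finset.sum_insert hi, Finset.sum_insert hi, star_add_left, ih]

theorem star_sum_right (K : Type) [Field K] {ι : Type*} (s : Finset ι) (f : ι → FW K) (x : FW K) :
    starF K x (∑ i ∈ s, f i) = ∑ i ∈ s, starF K x (f i) := by
  induction s using Finset.induction_on with
  | empty => simp [starF]
  | insert i s hi ih => rw [Finset.sum_insert hi, Finset.sum_insert hi, star_add_right, ih]

theorem QS_PF {a b : W} (ha : IsPF a) (hb : IsPF b) {G : Finset W}
    (h : G ∈ QS (FF a) (shS a.length (FF b))) :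
    IsPF (wordOfSet G) ∧ FF (wordOfSet G) = G ∧ (wordOfSet G).length = a.length + b.length := by
  rw [mem_QS (low_FF ha) (shS_high (high_FF hb))] at h
  have p := word_perm h
  refine ⟨PF_perm (PF_shift ha hb) p.symm, FF_word (QQ_good (good_FF a) (shS_good (good_FF b)) h), ?_⟩
  rw [p.length_eq]
  simp [shiftW]

theorem shS_zero (G : Finset W) : shS 0 G = G := by
  unfold shS
  have : shiftW 0 = id := by funext g; simp [shiftW]
  rw [this, Finset.image_id]

theorem FF_nil : FF [] = ∅ := by
  unfold FF LR; rw [segs_nil]; rfl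

/-- The product `⋆` on `KP` is associative with two-sided unit
`M_ε`: the products of basis elements indexed by parking functions again lie in
the span of parking functions, `⋆` is associative there, and `M_ε` is a unit. -/
theorem stmt2 (K : Type) [Field K] [CharZero K] :
    (∀ a b : W, IsPF a → IsPF b → ∀ Θ ∈ Rset a b, IsPF (mTheta a b Θ)) ∧
    (∀ a b c : W, IsPF a → IsPF b → IsPF c →
      starF K (starF K (Mb K a) (Mb K b)) (Mb K c) =
        starF K (Mb K a) (starF K (Mb K b) (Mb K c))) ∧
    (∀ a : W, IsPF a →
      starF K (Mb K []) (Mb K a) = Mb K a ∧ starF K (Mb K a) (Mb K []) = Mb K a) := by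
  refine ⟨?_, ?_, ?_⟩
  · intro a b ha hb Θ hΘ
    rw [Rset_eq] at hΘ
    rw [mTheta_eq]
    refine (QS_PF ha hb ?_).1
    exact Finset.mem_image_of_mem _ hΘ
  · intro a b c ha hb hc
    rw [star_single, star_single, mul_sum K ha hb, mul_sum K hb hc, star_sum_left, star_sum_right]
    have := main_sum (low_FF ha) (low_FF hb) (high_FF hb) (high_FF hc)
      (fun G => Mb K (wordOfSet G))
    refine Eq.trans ?_ (this.trans ?_)
    · apply Finset.sum_congr rfl
      intro H hH
      obtain ⟨h1, h2, h3⟩ := QS_PF ha hb hH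
      rw [star_single, mul_sum K h1 hc, h2, h3]
    · apply Finset.sum_congr rfl
      intro H hH
      obtain ⟨h1, h2, h3⟩ := QS_PF hb hc hH
      rw [star_single, mul_sum K ha h1, h2]
  · intro a ha
    rw [star_single, star_single]
    constructor
    · have e : MS (FF []) (shS ([] : W).length (FF a)) = {∅} := by
        rw [FF_nil]; ext Θ; simp [MS]; rintro rfl; simp
      rw [mulSingle, Rset_eq, e, Finset.sum_singleton, mTheta_eq]
      simp [glueSet, FF_nil, shS_zero, word_FF]
    · have e : MS (FF a) (shS a.length (FF [])) = {∅} := by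
        rw [FF_nil]; ext Θ; simp [MS, shS]; rintro rfl; simp
      rw [mulSingle, Rset_eq, e, Finset.sum_singleton, mTheta_eq]
      simp [glueSet, FF_nil, shS, word_FF]
end

section
/- Let c be a parking function of length m and let c' be any subword of c of length m'. Define j(c') recursively by j(c') = 0 if c' is a parking function, and j(c') = j(c̄') + 1 otherwise, where c̄' is the word obtained from c' in one step of the parkization algorithm. Then j(c') ≤ m − m'. -/
open scoped Classical

/-- Number of letters of `a` that are at most `i`. -/
def cntLe (a : W) (i : ℕ) : ℕ := a.countP (fun x => decide (x ≤ i))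

/-- `a` is a parking function up to slack `s`. -/
def SlackPF (a : W) (s : ℕ) : Prop :=
  (∀ x ∈ a, 1 ≤ x) ∧ ∀ i, i ≤ a.length → i ≤ cntLe a (i + s)

theorem cntLe_sort (a : W) (i : ℕ) :
    cntLe (a.insertionSort (· ≤ ·)) i = cntLe a i :=
  (List.perm_insertionSort (· ≤ ·) a).countP_eq _

theorem slack_of_isPF (a : W) (h : IsPF a) : SlackPF a 0 := by
  refine ⟨h.1, fun i hi => ?_⟩
  rw [← cntLe_sort]
  have hl : (a.insertionSort (· ≤ ·)).length = a.length := List.length_insertionSort _ _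
  have hs : (a.insertionSort (· ≤ ·)).Pairwise (· ≤ ·) := List.pairwise_insertionSort _ _
  have h2 := h.2
  generalize a.insertionSort (· ≤ ·) = t at *
  have h3 : cntLe (t.take i) (i + 0) ≤ cntLe t (i + 0) :=
    (List.take_sublist i t).countP_le
  have h4 : cntLe (t.take i) (i + 0) = (t.take i).length := by
    unfold cntLe
    rw [List.countP_eq_length]
    intro x hx
    obtain ⟨k, hk, rfl⟩ := List.mem_iff_getElem.1 hx
    have hk' : k < i ∧ k < t.length := by simpa using hk
    have := h2 k (by omega)
    rw [List.getD_eq_getElem _ _ hk'.2] at this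
    simp only [List.getElem_take, decide_eq_true_eq]
    omega
  have h5 : (t.take i).length = i := by rw [List.length_take]; omega
  omega

theorem isPF_of_slack (a : W) (h : SlackPF a 0) : IsPF a := by
  refine ⟨h.1, fun i hi => ?_⟩
  have h2 := h.2 (i + 1) hi
  rw [← cntLe_sort] at h2
  have hl : (a.insertionSort (· ≤ ·)).length = a.length := List.length_insertionSort _ _
  have hs : (a.insertionSort (· ≤ ·)).Pairwise (· ≤ ·) := List.pairwise_insertionSort _ _
  generalize a.insertionSort (· ≤ ·) = t at *
  have hit : i < t.length := by omega
  rw [List.getD_eq_getElem _ _ hit]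
  by_contra! hcon
  have h3 : cntLe t (i + 1 + 0) = cntLe (t.take i) (i + 1 + 0) + cntLe (t.drop i) (i + 1 + 0) := by
    unfold cntLe
    rw [← List.countP_append, List.take_append_drop]
  have h4 : cntLe (t.take i) (i + 1 + 0) ≤ (t.take i).length := List.countP_le_length
  have h5 : (t.take i).length = i := by rw [List.length_take]; omega
  have h6 : cntLe (t.drop i) (i + 1 + 0) = 0 := by
    unfold cntLe
    rw [List.countP_eq_zero]
    intro x hx
    obtain ⟨k, hk, rfl⟩ := List.mem_iff_getElem.1 hx
    have hk' : i + k < t.length := by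
      rw [List.length_drop] at hk; omega
    simp only [List.getElem_drop, decide_eq_true_eq]
    rcases Nat.eq_zero_or_pos k with rfl | hkp
    · simp only [Nat.add_zero]; omega
    · have := List.pairwise_iff_getElem.1 hs i (i + k) hit hk' (by omega)
      omega
  omega

theorem dVal_pos (a : W) : 1 ≤ dVal a := by
  have h := Nat.find_spec (p := fun i => (a.filter (fun x => x ≤ i)).length < i)
    ⟨a.length + 1, Nat.lt_succ_of_le (List.length_filter_le _ _)⟩
  change _ < dVal a at h
  omega

theorem le_cntLe_of_lt_dVal (a : W) (i : ℕ) (h : i < dVal a) : i ≤ cntLe a i := by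
  have h := Nat.find_min (p := fun i => (a.filter (fun x => x ≤ i)).length < i)
    ⟨a.length + 1, Nat.lt_succ_of_le (List.length_filter_le _ _)⟩ h
  unfold cntLe
  rw [List.countP_eq_length_filter]
  exact not_lt.1 h

theorem slack_step (a : W) (s : ℕ) (h : SlackPF a (s + 1)) : SlackPF (parkStep a) s := by
  have hd := dVal_pos a
  refine ⟨fun x hx => ?_, fun i hi => ?_⟩
  · obtain ⟨y, hy, rfl⟩ := List.mem_map.1 hx
    have := h.1 y hy
    split_ifs <;> omega
  · have hi' : i ≤ a.length := by simpa [parkStep] using hi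
    by_cases hc : i + s < dVal a
    · have h1 := le_cntLe_of_lt_dVal a (i + s) hc
      have h2 : cntLe a (i + s) ≤ cntLe (parkStep a) (i + s) := by
        unfold cntLe parkStep
        rw [List.countP_map]
        apply List.countP_mono_left
        intro x _ hx
        simp only [decide_eq_true_eq, Function.comp] at hx ⊢
        split_ifs <;> omega
      omega
    · have h1 := h.2 i hi'
      have h2 : cntLe a (i + (s + 1)) ≤ cntLe (parkStep a) (i + s) := by
        unfold cntLe parkStep
        rw [List.countP_map]
        apply List.countP_mono_left
        intro x _ hx
        simp only [decide_eq_true_eq, Function.comp] at hx ⊢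
        split_ifs <;> omega
      omega

theorem slack_iter (s : ℕ) : ∀ a : W, SlackPF a s → SlackPF (parkStep^[s] a) 0 := by
  induction s with
  | zero => intro a h; exact h
  | succ s ih =>
    intro a h
    rw [Function.iterate_succ_apply]
    exact ih _ (slack_step a s h)

theorem slack_sub (c c' : W) (hc : IsPF c) (hsub : c'.Sublist c) :
    SlackPF c' (c.length - c'.length) := by
  have h := slack_of_isPF c hc
  have hlen := hsub.length_le
  refine ⟨fun x hx => h.1 x (hsub.subset hx), fun i hi => ?_⟩
  have h1 := h.2 (i + (c.length - c'.length)) (by omega)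
  have h2 := hsub.countP_le (p := fun x => !decide (x ≤ i + (c.length - c'.length)))
  have h3 := List.length_eq_countP_add_countP
    (fun x => decide (x ≤ i + (c.length - c'.length))) (l := c)
  have h4 := List.length_eq_countP_add_countP
    (fun x => decide (x ≤ i + (c.length - c'.length))) (l := c')
  simp only [Nat.add_zero] at h1
  unfold cntLe at *
  simp only [decide_eq_true_eq, Bool.not_eq_true, decide_eq_false_iff_not, ← decide_not] at *
  omega

/-- If `c` is a parking function of length `m` and `c'` is a
subword of `c` of length `m'`, then the number `j(c')` of steps of the
parkization algorithm on `c'` (the least `k` with `parkStep^[k] c'` a parking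
function) satisfies `j(c') ≤ m - m'`. -/
theorem stmt3 (c c' : W) (hc : IsPF c) (hsub : c'.Sublist c) :
    {k : ℕ | IsPF (parkStep^[k] c')}.Nonempty ∧
    sInf {k : ℕ | IsPF (parkStep^[k] c')} ≤ c.length - c'.length := by
  have h := isPF_of_slack _ (slack_iter _ _ (slack_sub c c' hc hsub))
  exact ⟨⟨_, h⟩, Nat.sInf_le h⟩
end
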